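/- arXiv:2007.10164 — 7 statements merged into one kernel-verified Lean document; each statement's English description precedes it below -/
import Mathlib

section
/- Let α, β > 0 be real numbers with α^2·β^2 < 1/4, let f(γ) = α·(1 + β^2·γ^2), and let γ* = (1 - √(1 - 4α^2β^2))/(2αβ^2). Then α ≤ γ*, and for every initial value γ₀ ∈ [0, γ*], the sequence defined by γ_{t+1} = f(γ_t) is monotone nondecreasing, remains in [0, γ*], and converges to γ* as t → ∞. In particular, the iteration started from γ₀ = α converges to γ*. -/
open Filter Topology

/-- Iterating `x ↦ a + c x²` from below a fixed point `g` with `2cg ≤ 1` increases to `g`. -/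
theorem monotone_and_tendsto_of_quadratic_iteration {a c g : ℝ} (ha : 0 ≤ a) (hc : 0 < c)
    (hg : a + c * g ^ 2 = g) (hcg : 2 * c * g ≤ 1) {u : ℕ → ℝ} (h0 : u 0 ∈ Set.Icc 0 g)
    (hu : ∀ t, u (t + 1) = a + c * u t ^ 2) :
    Monotone u ∧ (∀ t, u t ∈ Set.Icc 0 g) ∧ Tendsto u atTop (𝓝 g) := by
  have hmem : ∀ t, u t ∈ Set.Icc 0 g := by
    intro t
    induction t with
    | zero => exact h0
    | succ t ih =>
      have hsq : c * u t ^ 2 ≤ c * g ^ 2 :=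
        mul_le_mul_of_nonneg_left (pow_le_pow_left₀ ih.1 ih.2 2) hc.le
      rw [hu t]
      exact ⟨by positivity, by linarith⟩
  have hmono : Monotone u := by
    refine monotone_nat_of_le_succ fun t => ?_
    have hsum : 0 ≤ 1 - c * (u t + g) := by
      linarith [mul_le_mul_of_nonneg_left (hmem t).2 hc.le]
    rw [hu t]
    linarith [mul_nonneg (sub_nonneg.2 (hmem t).2) hsum]
  refine ⟨hmono, hmem, ?_⟩
  have hbdd : BddAbove (Set.range u) := ⟨g, by rintro _ ⟨t, rfl⟩; exact (hmem t).2⟩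
  obtain ⟨L, hL⟩ : ∃ L, Tendsto u atTop (𝓝 L) := ⟨_, tendsto_atTop_ciSup hmono hbdd⟩
  have hLg : L ≤ g := le_of_tendsto' hL fun t => (hmem t).2
  have hfix : L = a + c * L ^ 2 := by
    refine tendsto_nhds_unique (hL.comp (tendsto_add_atTop_nat 1)) ?_
    exact (((hL.pow 2).const_mul c).const_add a).congr fun t => (hu t).symm
  rcases hLg.eq_or_lt with rfl | hlt
  · exact hL
  · have hsum : 0 < 1 - c * (L + g) := by
      linarith [mul_lt_mul_of_pos_left hlt hc]
    linarith [mul_pos (sub_pos.2 hlt) hsum]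

/-- For `α, β > 0` with `α²β² < 1/4`, let `f(γ) = α(1 + β²γ²)` and
`γ* = (1 - √(1-4α²β²))/(2αβ²)`. Then `α ≤ γ*`, and for every initial value
`γ₀ ∈ [0, γ*]` the iteration `γ_{t+1} = f(γ_t)` is monotone nondecreasing, stays
in `[0, γ*]`, and converges to `γ*`. In particular, the iteration started from
`γ₀ = α` converges to `γ*`. -/
theorem sw_iteration_convergence (α β : ℝ) (hα : 0 < α) (hβ : 0 < β)
    (h : α ^ 2 * β ^ 2 < 1 / 4) :
    let f : ℝ → ℝ := fun γ => α * (1 + β ^ 2 * γ ^ 2)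
    let γstar : ℝ := (1 - Real.sqrt (1 - 4 * α ^ 2 * β ^ 2)) / (2 * α * β ^ 2)
    α ≤ γstar ∧
    (∀ γ : ℕ → ℝ, γ 0 ∈ Set.Icc 0 γstar → (∀ t : ℕ, γ (t + 1) = f (γ t)) →
      Monotone γ ∧ (∀ t : ℕ, γ t ∈ Set.Icc 0 γstar) ∧
        Tendsto γ atTop (𝓝 γstar)) ∧
    (∀ γ : ℕ → ℝ, γ 0 = α → (∀ t : ℕ, γ (t + 1) = f (γ t)) →
      Tendsto γ atTop (𝓝 γstar)) := by
  intro f γstar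
  have hc : 0 < α * β ^ 2 := by positivity
  have hs : 0 ≤ √(1 - 4 * α ^ 2 * β ^ 2) := Real.sqrt_nonneg _
  have hss : √(1 - 4 * α ^ 2 * β ^ 2) ^ 2 = 1 - 4 * α ^ 2 * β ^ 2 :=
    Real.sq_sqrt (by linarith)
  have hmul : 2 * (α * β ^ 2) * γstar = 1 - √(1 - 4 * α ^ 2 * β ^ 2) := by
    simp only [γstar]
    field_simp
  have hfix : α + α * β ^ 2 * γstar ^ 2 = γstar := by
    rw [show √(1 - 4 * α ^ 2 * β ^ 2) = 1 - 2 * (α * β ^ 2) * γstar by linarith] at hss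
    refine mul_left_cancel₀ hc.ne' ?_
    linarith
  have hle : α ≤ γstar := by
    have : 0 ≤ α * β ^ 2 * γstar ^ 2 := by positivity
    linarith
  have key : ∀ γ : ℕ → ℝ, γ 0 ∈ Set.Icc 0 γstar → (∀ t, γ (t + 1) = f (γ t)) →
      Monotone γ ∧ (∀ t, γ t ∈ Set.Icc 0 γstar) ∧ Tendsto γ atTop (𝓝 γstar) :=
    fun γ h0 hγ => monotone_and_tendsto_of_quadratic_iteration hα.le hc hfix (by linarith) h0
      fun t => by rw [hγ t]; simp only [f]; ring
  exact ⟨hle, key, fun γ h0 hγ => (key γ (h0 ▸ ⟨hα.le, hle⟩) hγ).2.2⟩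
end

section
/- Let X_LS be a nonzero complex number and σ^2 > 0 a real number with |X_LS|^2 > 4σ^2 (equivalently |Z| > 2 where |Z|^2 = |X_LS|^2/σ^2). Define X̂ = X_LS · (1 + √(1 - 4σ^2/|X_LS|^2))/2. Then X̂ ≠ 0 and X̂ satisfies the implicit Self-Wiener equation X̂ = X_LS / (1 + σ^2/|X̂|^2); moreover X̂ has the same phase as X_LS, i.e., X̂/|X̂| = X_LS/|X_LS|. -/
/-- For nonzero `X_LS ∈ ℂ` and `σ² > 0` with `|X_LS|² > 4σ²`, the
Self-Wiener estimate `X̂ = X_LS·(1 + √(1 - 4σ²/|X_LS|²))/2` is nonzero, satisfies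
the implicit equation `X̂ = X_LS/(1 + σ²/|X̂|²)`, and has the same phase as
`X_LS`, i.e. `X̂/|X̂| = X_LS/|X_LS|`. -/
theorem sw_implicit_solution (XLS : ℂ) (hXLS : XLS ≠ 0) (σ2 : ℝ) (hσ2 : 0 < σ2)
    (hthr : 4 * σ2 < ‖XLS‖ ^ 2) :
    let Xhat : ℂ := XLS * (((1 + Real.sqrt (1 - 4 * σ2 / ‖XLS‖ ^ 2)) / 2 : ℝ) : ℂ)
    Xhat ≠ 0 ∧
    Xhat = XLS / (1 + ((σ2 / ‖Xhat‖ ^ 2 : ℝ) : ℂ)) ∧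
    Xhat / (‖Xhat‖ : ℂ) = XLS / (‖XLS‖ : ℂ) := by
  intro Xhat
  have hn : 0 < ‖XLS‖ := norm_pos_iff.mpr hXLS
  have hs : Real.sqrt (1 - 4 * σ2 / ‖XLS‖ ^ 2) ^ 2 = 1 - 4 * σ2 / ‖XLS‖ ^ 2 :=
    Real.sq_sqrt (sub_nonneg.mpr ((div_le_one (by positivity)).mpr hthr.le))
  obtain ⟨r, hr⟩ : ∃ r, r = (1 + Real.sqrt (1 - 4 * σ2 / ‖XLS‖ ^ 2)) / 2 := ⟨_, rfl⟩
  have hr0 : 0 < r := by rw [hr]; positivity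
  have hquad : r ^ 2 + σ2 / ‖XLS‖ ^ 2 = r := by
    rw [hr]
    linear_combination hs / 4
  have hX : Xhat = XLS * (r : ℂ) := by rw [hr]
  have hnorm : ‖Xhat‖ = ‖XLS‖ * r := by
    rw [hX, norm_mul, Complex.norm_real, Real.norm_of_nonneg hr0.le]
  have hr0' : (r : ℂ) ≠ 0 := Complex.ofReal_ne_zero.mpr hr0.ne'
  have hfix : r * (1 + σ2 / ‖Xhat‖ ^ 2) = 1 := by
    rw [hnorm]
    field_simp at hquad ⊢
    linear_combination hquad
  have hden : (1 : ℂ) + ((σ2 / ‖Xhat‖ ^ 2 : ℝ) : ℂ) ≠ 0 := by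
    exact_mod_cast (by positivity : 0 < 1 + σ2 / ‖Xhat‖ ^ 2).ne'
  refine ⟨?_, ?_, ?_⟩
  · rw [hX]
    exact mul_ne_zero hXLS hr0'
  · have hfix' : (r : ℂ) * (1 + ((σ2 / ‖Xhat‖ ^ 2 : ℝ) : ℂ)) = 1 := by
      exact_mod_cast hfix
    rw [eq_div_iff hden]
    calc Xhat * (1 + ((σ2 / ‖Xhat‖ ^ 2 : ℝ) : ℂ))
        = XLS * (r * (1 + ((σ2 / ‖Xhat‖ ^ 2 : ℝ) : ℂ))) := by rw [← mul_assoc, ← hX]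
      _ = XLS := by rw [hfix', mul_one]
  · rw [hnorm, hX, Complex.ofReal_mul, mul_div_mul_right _ _ hr0']
end

section
/- There exists a constant C > 0 such that for every real number z ≥ 3, |(1 + √(1 - 4/z^2))/2 - 1/(1 + 1/z^2)| ≤ C/z^4. Equivalently, at high estimated output SNR the Self-Wiener shrinkage factor 2·z^{-2}/(1 - √(1 - 4·z^{-2})) agrees with the Wiener-type regularization factor 1/(1 + z^{-2}) up to an error of order z^{-4}. -/
theorem abs_half_one_add_sqrt_sub_inv_le {u : ℝ} (hu : 0 ≤ u) (hu' : u ≤ 1 / 9) :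
    |(1 + Real.sqrt (1 - 4 * u)) / 2 - 1 / (1 + u)| ≤ 3 * u ^ 2 := by
  have sqrt_le : Real.sqrt (1 - 4 * u) ≤ 1 - 2 * u :=
    Real.sqrt_le_iff.mpr ⟨by linarith, by nlinarith [sq_nonneg u]⟩
  have le_sqrt : 1 - 2 * u - 4 * u ^ 2 ≤ Real.sqrt (1 - 4 * u) := by
    apply Real.le_sqrt_of_sq_le
    have h : 0 ≤ 1 - 4 * u - 4 * u ^ 2 := by nlinarith
    nlinarith [mul_nonneg (sq_nonneg u) h]
  have le_inv : 1 - u ≤ 1 / (1 + u) := by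
    rw [le_div_iff₀ (by linarith)]
    nlinarith [sq_nonneg u]
  have inv_le : 1 / (1 + u) ≤ 1 - u + u ^ 2 := by
    rw [div_le_iff₀ (by linarith)]
    nlinarith [pow_nonneg hu 3]
  rw [abs_le]
  constructor <;> nlinarith [sq_nonneg u]

/-- There is `C > 0` such that for all `z ≥ 3`,
`|(1 + √(1 - 4/z²))/2 - 1/(1 + 1/z²)| ≤ C/z⁴`: at high estimated output SNR the
Self-Wiener shrinkage factor agrees with the Wiener-type regularization factor
up to an error of order `z⁻⁴`. -/
theorem sw_shrinkage_high_snr_approx :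
    ∃ C > 0, ∀ z : ℝ, 3 ≤ z →
      |(1 + Real.sqrt (1 - 4 / z ^ 2)) / 2 - 1 / (1 + 1 / z ^ 2)| ≤ C / z ^ 4 := by
  refine ⟨3, by norm_num, fun z hz => ?_⟩
  have hz2 : 1 / z ^ 2 ≤ 1 / 9 := one_div_le_one_div_of_le (by norm_num) (by nlinarith)
  have h := abs_half_one_add_sqrt_sub_inv_le (u := 1 / z ^ 2) (by positivity) hz2
  rwa [mul_one_div, show 3 * (1 / z ^ 2) ^ 2 = 3 / z ^ 4 by ring] at h
end

section
/- Let V be a standard complex Gaussian random variable, i.e., V = V_r + i·V_i where V_r and V_i are independent real Gaussian random variables with mean 0 and variance 1/2, and for η ∈ ℂ let p(η) = P(|η + V| > 2). Then there exists a constant C > 0 such that for all η with |η| ≤ 1, |p(η) - e^{-4}| ≤ C·|η|^2. -/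
open MeasureTheory ProbabilityTheory Complex

/-- The density of the standard complex Gaussian distribution. -/
noncomputable def complexGaussianPDF (z : ℂ) : ℝ := Real.pi⁻¹ * Real.exp (-‖z‖ ^ 2)

lemma complexGaussianPDF_nonneg (z : ℂ) : 0 ≤ complexGaussianPDF z := by
  unfold complexGaussianPDF; positivity

lemma complexGaussianPDF_neg (z : ℂ) : complexGaussianPDF (-z) = complexGaussianPDF z := by
  simp [complexGaussianPDF]

@[fun_prop]
lemma continuous_complexGaussianPDF : Continuous complexGaussianPDF := by
  unfold complexGaussianPDF; fun_prop

lemma gaussianPDF_mul_gaussianPDF (p : ℝ × ℝ) :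
    gaussianPDF 0 (1 / 2) p.1 * gaussianPDF 0 (1 / 2) p.2 =
      ENNReal.ofReal (complexGaussianPDF (measurableEquivRealProd.symm p)) := by
  obtain ⟨x, y⟩ := p
  rw [gaussianPDF, gaussianPDF, ← ENNReal.ofReal_mul (gaussianPDFReal_nonneg _ _ _)]
  congr 1
  have hnorm : ‖measurableEquivRealProd.symm (x, y)‖ ^ 2 = x ^ 2 + y ^ 2 := by
    rw [← Complex.normSq_eq_norm_sq, Complex.normSq_apply]
    simp [measurableEquivRealProd_symm_apply]
    ring
  have hpi : (√Real.pi)⁻¹ * (√Real.pi)⁻¹ = Real.pi⁻¹ := by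
    rw [← mul_inv, Real.mul_self_sqrt Real.pi_nonneg]
  have htwo : 2 * (((1 / 2 : NNReal)) : ℝ) = 1 := by norm_num
  have hvar : 2 * Real.pi * (((1 / 2 : NNReal)) : ℝ) = Real.pi := by
    rw [mul_right_comm, htwo, one_mul]
  rw [complexGaussianPDF, hnorm, gaussianPDFReal, gaussianPDFReal, htwo, hvar, mul_mul_mul_comm,
    hpi, ← Real.exp_add]
  congr 2
  ring

lemma map_eq_withDensity_complexGaussianPDF {Ω : Type*} [MeasurableSpace Ω] {μ : Measure Ω}
    [IsProbabilityMeasure μ] {Vr Vi : Ω → ℝ} (hVrm : Measurable Vr) (hVim : Measurable Vi)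
    (hVr : μ.map Vr = gaussianReal 0 (1 / 2)) (hVi : μ.map Vi = gaussianReal 0 (1 / 2))
    (hindep : IndepFun Vr Vi μ) :
    μ.map (fun ω ↦ (Vr ω : ℂ) + (Vi ω : ℂ) * Complex.I) =
      volume.withDensity fun z ↦ ENNReal.ofReal (complexGaussianPDF z) := by
  have hne : (1 / 2 : NNReal) ≠ 0 := by norm_num
  have hprod := (indepFun_iff_map_prod_eq_prod_map_map hVrm.aemeasurable
    hVim.aemeasurable).1 hindep
  rw [hVr, hVi, gaussianReal_of_var_ne_zero _ hne,
    prod_withDensity (measurable_gaussianPDF _ _) (measurable_gaussianPDF _ _)] at hprod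
  simp_rw [gaussianPDF_mul_gaussianPDF] at hprod
  have hcomp : (fun ω ↦ (Vr ω : ℂ) + (Vi ω : ℂ) * Complex.I) =
      measurableEquivRealProd.symm ∘ fun ω ↦ (Vr ω, Vi ω) := by
    ext ω
    apply Complex.ext <;> simp [measurableEquivRealProd_symm_apply]
  rw [hcomp, ← Measure.map_map measurableEquivRealProd.symm.measurable (by fun_prop), hprod]
  ext s hs
  rw [Measure.map_apply measurableEquivRealProd.symm.measurable hs,
    withDensity_apply _ hs,
    withDensity_apply _ (measurableEquivRealProd.symm.measurable hs)]
  exact volume_preserving_equiv_real_prod.symm.setLIntegral_comp_preimage_emb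
    measurableEquivRealProd.symm.measurableEmbedding
    (fun z ↦ ENNReal.ofReal (complexGaussianPDF z)) s

lemma integral_mul_exp_neg_sq (r : ℝ) :
    ∫ x in (0 : ℝ)..r, x * Real.exp (-x ^ 2) = (1 - Real.exp (-r ^ 2)) / 2 := by
  have hderiv : ∀ x ∈ Set.uIcc 0 r,
      HasDerivAt (fun x : ℝ ↦ -Real.exp (-x ^ 2) / 2) (x * Real.exp (-x ^ 2)) x := by
    intro x _
    convert! (((hasDerivAt_pow 2 x).neg.exp).neg.div_const 2) using 1
    simp
    ring
  rw [intervalIntegral.integral_eq_sub_of_hasDerivAt hderiv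
    ((by fun_prop : Continuous fun x : ℝ ↦ x * Real.exp (-x ^ 2)).intervalIntegrable _ _)]
  simp
  ring

lemma setIntegral_closedBall_complexGaussianPDF {r : ℝ} (hr : 0 ≤ r) :
    ∫ z in Metric.closedBall 0 r, complexGaussianPDF z = 1 - Real.exp (-r ^ 2) := by
  calc
    _ = ∫ x in Set.Ioi (0 : ℝ) ×ˢ Set.Ioo (-Real.pi) Real.pi,
        (Set.Iic r).indicator (fun x ↦ x * Real.exp (-x ^ 2)) x.1 * Real.pi⁻¹ := by
      rw [← integral_indicator Metric.isClosed_closedBall.measurableSet,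
        ← Complex.integral_comp_polarCoord_symm, polarCoord_target]
      refine setIntegral_congr_fun (measurableSet_Ioi.prod measurableSet_Ioo) fun p hp ↦ ?_
      have hp0 : 0 < p.1 := hp.1
      simp only [Set.indicator, Metric.mem_closedBall, dist_zero_right,
        Complex.norm_polarCoord_symm, abs_of_pos hp0, complexGaussianPDF, Set.mem_Iic, smul_eq_mul]
      split_ifs <;> ring
    _ = (∫ x in Set.Ioi (0 : ℝ), (Set.Iic r).indicator (fun x ↦ x * Real.exp (-x ^ 2)) x) *
        ∫ _ in Set.Ioo (-Real.pi) Real.pi, Real.pi⁻¹ := by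
      rw [← setIntegral_prod_mul, Measure.volume_eq_prod]
    _ = (∫ x in (0 : ℝ)..r, x * Real.exp (-x ^ 2)) * 2 := by
      rw [setIntegral_indicator measurableSet_Iic, Set.Ioi_inter_Iic,
        ← intervalIntegral.integral_of_le hr, setIntegral_const,
        Real.volume_real_Ioo_of_le (by linarith [Real.pi_nonneg]), smul_eq_mul]
      have := Real.pi_ne_zero
      field_simp
      ring
    _ = _ := by rw [integral_mul_exp_neg_sq]; ring

lemma setIntegral_closedBall_neg_complexGaussianPDF (η : ℂ) (r : ℝ) :
    ∫ z in Metric.closedBall (-η) r, complexGaussianPDF z =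
      ∫ z in Metric.closedBall 0 r,
        (complexGaussianPDF (z - η) + complexGaussianPDF (z + η)) / 2 := by
  have hsub : ∫ z in Metric.closedBall (-η) r, complexGaussianPDF z =
      ∫ z in Metric.closedBall 0 r, complexGaussianPDF (z - η) := by
    rw [← (measurePreserving_sub_right volume η).setIntegral_preimage_emb
      (MeasurableEquiv.subRight η).measurableEmbedding]
    congr 2
    ext z
    simp [dist_eq_norm]
  have hadd : ∫ z in Metric.closedBall 0 r, complexGaussianPDF (z - η) =
      ∫ z in Metric.closedBall 0 r, complexGaussianPDF (z + η) := by
    rw [← (Measure.measurePreserving_neg (volume : Measure ℂ)).setIntegral_preimage_emb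
      (MeasurableEquiv.neg ℂ).measurableEmbedding]
    congr 1
    · congr 1
      ext z
      simp
    · ext z
      rw [← complexGaussianPDF_neg]
      congr 1
      ring
  have hint (a : ℂ) : IntegrableOn (fun z ↦ complexGaussianPDF (z + a))
      (Metric.closedBall 0 r) :=
    (by fun_prop : Continuous fun z ↦ complexGaussianPDF (z + a)).continuousOn.integrableOn_compact
      (isCompact_closedBall 0 r)
  rw [integral_div, integral_add (by simpa only [sub_eq_add_neg, IntegrableOn] using hint (-η))
    (hint η), hsub, ← hadd]
  ring

lemma complexGaussianPDF_sub_add_add (z η : ℂ) :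
    (complexGaussianPDF (z - η) + complexGaussianPDF (z + η)) / 2 =
      complexGaussianPDF z * (Real.exp (-‖η‖ ^ 2) * Real.cosh (2 * inner ℝ z η)) := by
  rw [complexGaussianPDF, complexGaussianPDF, complexGaussianPDF, norm_sub_sq_real,
    norm_add_sq_real, Real.cosh_eq,
    show -(‖z‖ ^ 2 - 2 * inner ℝ z η + ‖η‖ ^ 2) =
      -‖z‖ ^ 2 + -‖η‖ ^ 2 + 2 * inner ℝ z η by ring,
    show -(‖z‖ ^ 2 + 2 * inner ℝ z η + ‖η‖ ^ 2) =
      -‖z‖ ^ 2 + -‖η‖ ^ 2 + -(2 * inner ℝ z η) by ring,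
    Real.exp_add _ (2 * inner ℝ z η), Real.exp_add _ (-(2 * inner ℝ z η)), Real.exp_add]
  ring

lemma abs_exp_mul_cosh_sub_one_le {z η : ℂ} (hz : ‖z‖ ≤ 2) (hη : ‖η‖ ≤ 1) :
    |Real.exp (-‖η‖ ^ 2) * Real.cosh (2 * inner ℝ z η) - 1| ≤
      7 * Real.exp 7 * ‖η‖ ^ 2 := by
  have hη2 : ‖η‖ ^ 2 ≤ 1 := pow_le_one₀ (norm_nonneg _) hη
  have hinner : (inner ℝ z η) ^ 2 ≤ 4 * ‖η‖ ^ 2 := by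
    have h : |inner ℝ z η| ≤ 2 * ‖η‖ :=
      (abs_real_inner_le_norm z η).trans (by gcongr)
    calc (inner ℝ z η) ^ 2 = |inner ℝ z η| ^ 2 := (sq_abs _).symm
      _ ≤ (2 * ‖η‖) ^ 2 := by gcongr
      _ = _ := by ring
  have hupper : Real.exp (-‖η‖ ^ 2) * Real.cosh (2 * inner ℝ z η) ≤
      Real.exp (7 * ‖η‖ ^ 2) := by
    calc _ ≤ Real.exp (-‖η‖ ^ 2) * Real.exp ((2 * inner ℝ z η) ^ 2 / 2) := by
          gcongr; exact Real.cosh_le_exp_half_sq _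
      _ = Real.exp (-‖η‖ ^ 2 + (2 * inner ℝ z η) ^ 2 / 2) := (Real.exp_add _ _).symm
      _ ≤ _ := Real.exp_le_exp.2 (by linarith)
  have hlower : 1 - ‖η‖ ^ 2 ≤ Real.exp (-‖η‖ ^ 2) * Real.cosh (2 * inner ℝ z η) := by
    calc 1 - ‖η‖ ^ 2 ≤ Real.exp (-‖η‖ ^ 2) := by linarith [Real.add_one_le_exp (-‖η‖ ^ 2)]
      _ ≤ _ := le_mul_of_one_le_right (Real.exp_pos _).le (Real.one_le_cosh _)
  have hexp : Real.exp (7 * ‖η‖ ^ 2) - 1 ≤ 7 * Real.exp 7 * ‖η‖ ^ 2 := by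
    have h1 : 1 - 7 * ‖η‖ ^ 2 ≤ Real.exp (-(7 * ‖η‖ ^ 2)) := by
      linarith [Real.add_one_le_exp (-(7 * ‖η‖ ^ 2))]
    have h2 := mul_le_mul_of_nonneg_left h1 (Real.exp_pos (7 * ‖η‖ ^ 2)).le
    rw [← Real.exp_add, add_neg_cancel, Real.exp_zero] at h2
    have h3 : Real.exp (7 * ‖η‖ ^ 2) ≤ Real.exp 7 := Real.exp_le_exp.2 (by linarith)
    nlinarith [sq_nonneg ‖η‖]
  rw [abs_le]
  constructor
  · nlinarith [sq_nonneg ‖η‖, Real.one_le_exp (show (0 : ℝ) ≤ 7 by norm_num)]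
  · linarith

lemma abs_setIntegral_complexGaussianPDF_sub_le {η : ℂ} (hη : ‖η‖ ≤ 1) :
    |(∫ z in Metric.closedBall (-η) 2, complexGaussianPDF z) -
      ∫ z in Metric.closedBall 0 2, complexGaussianPDF z| ≤ 7 * Real.exp 7 * ‖η‖ ^ 2 := by
  have hint {f : ℂ → ℝ} (hf : Continuous f) : IntegrableOn f (Metric.closedBall 0 2) :=
    hf.continuousOn.integrableOn_compact (isCompact_closedBall 0 2)
  rw [setIntegral_closedBall_neg_complexGaussianPDF,
    ← integral_sub (hint (by fun_prop)) (hint (by fun_prop))]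
  calc
    _ ≤ ∫ z in Metric.closedBall 0 2, complexGaussianPDF z * (7 * Real.exp 7 * ‖η‖ ^ 2) := by
      refine norm_integral_le_of_norm_le (f := fun z ↦
        (complexGaussianPDF (z - η) + complexGaussianPDF (z + η)) / 2 - complexGaussianPDF z)
        (hint (by fun_prop)) ?_
      refine ae_restrict_of_forall_mem Metric.isClosed_closedBall.measurableSet fun z hz ↦ ?_
      rw [complexGaussianPDF_sub_add_add, ← mul_sub_one, Real.norm_eq_abs, abs_mul,
        abs_of_nonneg (complexGaussianPDF_nonneg z)]
      exact mul_le_mul_of_nonneg_left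
        (abs_exp_mul_cosh_sub_one_le (mem_closedBall_zero_iff.1 hz) hη)
        (complexGaussianPDF_nonneg z)
    _ ≤ _ := by
      rw [integral_mul_const, setIntegral_closedBall_complexGaussianPDF zero_le_two]
      refine mul_le_of_le_one_left (by positivity) ?_
      linarith [Real.exp_pos (-2 ^ 2)]

/-- If `V = V_r + i·V_i` is a standard complex Gaussian and
`p(η) = P(|η + V| > 2)`, then there is `C > 0` such that for all `|η| ≤ 1`,
`|p(η) - e⁻⁴| ≤ C·|η|²` (low-SNR expansion of the threshold probability). -/
theorem sw_threshold_prob_low_snr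
    {Ω : Type*} [MeasurableSpace Ω] (μ : Measure Ω) [IsProbabilityMeasure μ]
    (Vr Vi : Ω → ℝ) (hVrm : Measurable Vr) (hVim : Measurable Vi)
    (hVr : μ.map Vr = gaussianReal 0 (1 / 2)) (hVi : μ.map Vi = gaussianReal 0 (1 / 2))
    (hindep : IndepFun Vr Vi μ)
    (V : Ω → ℂ) (hV : ∀ ω, V ω = (Vr ω : ℂ) + (Vi ω : ℂ) * Complex.I) :
    ∃ C > 0, ∀ η : ℂ, ‖η‖ ≤ 1 →
      |(μ {ω | 2 < ‖η + V ω‖}).toReal - Real.exp (-4)| ≤ C * ‖η‖ ^ 2 := by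
  refine ⟨7 * Real.exp 7, by positivity, fun η hη ↦ ?_⟩
  obtain rfl : V = fun ω ↦ (Vr ω : ℂ) + (Vi ω : ℂ) * Complex.I := funext hV
  set V := fun ω ↦ (Vr ω : ℂ) + (Vi ω : ℂ) * Complex.I
  have hVm : Measurable V := by fun_prop
  have hball : MeasurableSet (Metric.closedBall (-η) 2) :=
    Metric.isClosed_closedBall.measurableSet
  have hcompl : {ω | 2 < ‖η + V ω‖} = (V ⁻¹' Metric.closedBall (-η) 2)ᶜ := by
    ext ω
    simp [dist_eq_norm, add_comm]
  have hmass : μ.real (V ⁻¹' Metric.closedBall (-η) 2) =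
      ∫ z in Metric.closedBall (-η) 2, complexGaussianPDF z := by
    rw [← map_measureReal_apply hVm hball,
      map_eq_withDensity_complexGaussianPDF hVrm hVim hVr hVi hindep, Measure.real,
      withDensity_apply _ hball, integral_eq_lintegral_of_nonneg_ae
        (ae_of_all _ complexGaussianPDF_nonneg)
        continuous_complexGaussianPDF.aestronglyMeasurable]
  have hbound := abs_setIntegral_complexGaussianPDF_sub_le hη
  rw [setIntegral_closedBall_complexGaussianPDF zero_le_two, ← hmass] at hbound
  rw [hcompl, ← Measure.real, probReal_compl_eq_one_sub (hVm hball), abs_sub_comm]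
  convert! hbound using 2
  norm_num
  ring
end

section
/- Let V be a standard complex Gaussian random variable, i.e., V = V_r + i·V_i where V_r and V_i are independent real Gaussian random variables with mean 0 and variance 1/2, and for η ∈ ℂ set Z = η + V. Then there exist constants C > 0 and η₀ > 0 such that for all η with |η| ≥ η₀, | E[ |Z|^{-2} · 1{|Z| > 2} ] / P(|Z| > 2) - 1/|η|^2 | ≤ C/|η|^4; that is, the conditional expectation E[1/|Z|^2 given |Z| > 2] equals 1/|η|^2 + O(1/|η|^4) as |η| → ∞. -/
open MeasureTheory ProbabilityTheory Complex

lemma Complex.sq_norm_add_eq (η v : ℂ) :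
    ‖η + v‖ ^ 2 = ‖η‖ ^ 2 + 2 * (η.re * v.re + η.im * v.im) + ‖v‖ ^ 2 := by
  simp only [Complex.sq_norm, Complex.normSq_apply, Complex.add_re, Complex.add_im]
  ring

lemma Complex.abs_re_mul_re_add_im_mul_im_le (η v : ℂ) :
    |η.re * v.re + η.im * v.im| ≤ ‖η‖ * ‖v‖ := by
  apply abs_le_of_sq_le_sq _ (by positivity)
  rw [mul_pow]
  simp only [Complex.sq_norm, Complex.normSq_apply]
  nlinarith [sq_nonneg (η.re * v.im - η.im * v.re)]

/-- Off a disc of radius `2`, the first-order Taylor expansion of `v ↦ 1 / ‖η + v‖ ^ 2` at `0` has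
a remainder that is bounded, uniformly in `η`, by a polynomial in `‖v‖`. -/
lemma abs_inv_sq_norm_add_sub_le {η v : ℂ} (hη : 0 < ‖η‖) (h : 2 < ‖η + v‖) :
    |((‖η + v‖ ^ 2)⁻¹ - (‖η‖ ^ 2)⁻¹) * ‖η‖ ^ 4 + 2 * (η.re * v.re + η.im * v.im)|
      ≤ 33 * ‖v‖ ^ 2 + 9 * ‖v‖ ^ 4 := by
  have hZ := Complex.sq_norm_add_eq η v
  have ht := sq_le_sq' (abs_le.mp (Complex.abs_re_mul_re_add_im_mul_im_le η v)).1
    (abs_le.mp (Complex.abs_re_mul_re_add_im_mul_im_le η v)).2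
  have htri : ‖η‖ ≤ ‖η + v‖ + ‖v‖ := by simpa using norm_sub_le (η + v) v
  have hv := norm_nonneg v
  set t := η.re * v.re + η.im * v.im
  set z := ‖η + v‖
  set a := ‖η‖
  set b := ‖v‖
  have hz : 0 < z := by linarith
  have key : ((z ^ 2)⁻¹ - (a ^ 2)⁻¹) * a ^ 4 + 2 * t
      = (2 * t + b ^ 2) ^ 2 / z ^ 2 - b ^ 2 := by
    have hb : b ^ 2 = z ^ 2 - a ^ 2 - 2 * t := by linarith
    rw [hb]
    field_simp
    ring
  have hs : (2 * t + b ^ 2) ^ 2 ≤ 8 * (a * b) ^ 2 + 2 * b ^ 4 := by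
    nlinarith [sq_nonneg (2 * t - b ^ 2)]
  have hq : (2 * t + b ^ 2) ^ 2 / z ^ 2 ≤ 32 * b ^ 2 + 9 * b ^ 4 := by
    rw [div_le_iff₀ (by positivity)]
    refine hs.trans ?_
    have h4 : 4 ≤ z ^ 2 := by nlinarith
    have hb4 : 4 * b ^ 4 ≤ b ^ 4 * z ^ 2 := by nlinarith [pow_nonneg hv 4]
    rcases le_total b (a / 2) with hba | hba
    · have haz : a ^ 2 ≤ 4 * z ^ 2 := by nlinarith
      have := mul_le_mul_of_nonneg_right haz (sq_nonneg b)
      nlinarith [pow_nonneg hv 4]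
    · have hab : a ^ 2 ≤ 4 * b ^ 2 := by nlinarith
      have := mul_le_mul_of_nonneg_right hab (sq_nonneg b)
      nlinarith [mul_nonneg (sq_nonneg b) (sq_nonneg z)]
  have hq0 : 0 ≤ (2 * t + b ^ 2) ^ 2 / z ^ 2 := by positivity
  rw [key, abs_le]
  constructor <;> nlinarith [sq_nonneg b, pow_nonneg hv 4]

lemma norm_le_two_mul_norm_of_norm_add_le {η v : ℂ} (hη : 4 ≤ ‖η‖) (h : ‖η + v‖ ≤ 2) :
    ‖η‖ ≤ 2 * ‖v‖ := by
  have htri : ‖η‖ ≤ ‖η + v‖ + ‖v‖ := by simpa using norm_sub_le (η + v) v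
  linarith

/-- The conditional expectation of `1 / ‖η + V‖ ^ 2` given `2 < ‖η + V‖` for a centred complex
random variable `V` with a finite fourth moment. -/
theorem exists_abs_cond_inv_sq_norm_add_sub_le
    {Ω : Type*} [MeasurableSpace Ω] (μ : Measure Ω) [IsProbabilityMeasure μ]
    {V : Ω → ℂ} (hVm : Measurable V) (hV : MemLp V 4 μ)
    (hre : ∫ ω, (V ω).re ∂μ = 0) (him : ∫ ω, (V ω).im ∂μ = 0) :
    ∃ C > 0, ∃ η₀ > 0, ∀ η : ℂ, η₀ ≤ ‖η‖ →
      |(∫ ω in {ω | 2 < ‖η + V ω‖}, (‖η + V ω‖ ^ 2)⁻¹ ∂μ)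
          / (μ {ω | 2 < ‖η + V ω‖}).toReal
        - (‖η‖ ^ 2)⁻¹| ≤ C / ‖η‖ ^ 4 := by
  have hV4 : Integrable (fun ω ↦ ‖V ω‖ ^ 4) μ := hV.integrable_norm_pow (by norm_num)
  have hV2 : Integrable (fun ω ↦ ‖V ω‖ ^ 2) μ :=
    (hV.mono_exponent (by norm_num : (2 : ENNReal) ≤ 4)).integrable_norm_pow (by norm_num)
  have hV1 : Integrable V μ := hV.integrable (by norm_num)
  have hVre : Integrable (fun ω ↦ (V ω).re) μ := hV1.re
  have hVim : Integrable (fun ω ↦ (V ω).im) μ := hV1.im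
  have hdom : Integrable (fun ω ↦ 33 * ‖V ω‖ ^ 2 + 9 * ‖V ω‖ ^ 4) μ :=
    (hV2.const_mul 33).add (hV4.const_mul 9)
  set M := ∫ ω, (33 * ‖V ω‖ ^ 2 + 9 * ‖V ω‖ ^ 4) ∂μ
  have hM0 : 0 ≤ M := integral_nonneg fun ω ↦ by positivity
  refine ⟨2 * M + 1, by positivity, 4 + 2 * M, by positivity, fun η hη ↦ ?_⟩
  have hη4 : 4 ≤ ‖η‖ := by linarith
  have hη0 : 0 < ‖η‖ := by linarith
  set A := {ω | 2 < ‖η + V ω‖}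
  have hA : MeasurableSet A := measurableSet_lt measurable_const (hVm.const_add η).norm
  have hprob : 1 / 2 ≤ μ.real A := by
    have hle : μ.real Aᶜ * ‖η‖ ^ 2 ≤ M := by
      rw [← smul_eq_mul, ← integral_indicator_const _ hA.compl]
      refine integral_mono ((integrable_const _).indicator hA.compl) hdom fun ω ↦ ?_
      by_cases hω : ω ∈ A
      · simp only [Set.indicator_of_notMem (Set.notMem_compl_iff.mpr hω)]
        positivity
      · rw [Set.indicator_of_mem (Set.mem_compl hω)]
        have := norm_le_two_mul_norm_of_norm_add_le hη4 (not_lt.mp hω)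
        nlinarith [pow_nonneg (norm_nonneg (V ω)) 4]
    rw [probReal_compl_eq_one_sub hA] at hle
    nlinarith
  have hint : IntegrableOn (fun ω ↦ (‖η + V ω‖ ^ 2)⁻¹) A μ := by
    refine Measure.integrableOn_of_bounded (M := 1) (measure_ne_top μ A)
      (((hVm.const_add η).norm.pow_const 2).inv.aestronglyMeasurable)
      ((ae_restrict_iff' hA).mpr (.of_forall fun ω hω ↦ ?_))
    have hω : 2 < ‖η + V ω‖ := hω
    rw [Real.norm_of_nonneg (by positivity)]
    exact inv_le_one_of_one_le₀ (by nlinarith)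
  set f := A.indicator (fun ω ↦ (‖η + V ω‖ ^ 2)⁻¹ - (‖η‖ ^ 2)⁻¹) with hf
  have hfint : Integrable f μ := (hint.sub (integrable_const _).integrableOn).integrable_indicator hA
  have hfval : ∫ ω, f ω ∂μ = (∫ ω in A, (‖η + V ω‖ ^ 2)⁻¹ ∂μ) - μ.real A * (‖η‖ ^ 2)⁻¹ := by
    rw [hf, integral_indicator hA, integral_sub hint (integrable_const _).integrableOn,
      setIntegral_const, smul_eq_mul]
  have hlin : Integrable (fun ω ↦ 2 * (η.re * (V ω).re + η.im * (V ω).im)) μ :=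
    ((hVre.const_mul _).add (hVim.const_mul _)).const_mul 2
  have hlin0 : ∫ ω, 2 * (η.re * (V ω).re + η.im * (V ω).im) ∂μ = 0 := by
    rw [integral_const_mul, integral_add (hVre.const_mul _) (hVim.const_mul _),
      integral_const_mul, integral_const_mul, hre, him]
    simp
  have hbound : |∫ ω, f ω ∂μ| * ‖η‖ ^ 4 ≤ M := by
    have hsum : (∫ ω, f ω ∂μ) * ‖η‖ ^ 4
        = ∫ ω, (f ω * ‖η‖ ^ 4 + 2 * (η.re * (V ω).re + η.im * (V ω).im)) ∂μ := by
      rw [integral_add (hfint.mul_const _) hlin, hlin0, integral_mul_const, add_zero]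
    rw [← abs_of_nonneg (pow_nonneg hη0.le 4), ← abs_mul, hsum, ← Real.norm_eq_abs]
    refine norm_integral_le_of_norm_le hdom (.of_forall fun ω ↦ ?_)
    rw [Real.norm_eq_abs]
    by_cases hω : ω ∈ A
    · rw [hf, Set.indicator_of_mem hω]
      exact abs_inv_sq_norm_add_sub_le hη0 hω
    · rw [hf, Set.indicator_of_notMem hω, zero_mul, zero_add, abs_mul, abs_two]
      have h1 := norm_le_two_mul_norm_of_norm_add_le hη4 (not_lt.mp hω)
      have h2 := Complex.abs_re_mul_re_add_im_mul_im_le η (V ω)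
      nlinarith [pow_nonneg (norm_nonneg (V ω)) 4, norm_nonneg (V ω)]
  have hA0 : 0 < μ.real A := by linarith
  have hquot : (∫ ω in A, (‖η + V ω‖ ^ 2)⁻¹ ∂μ) / (μ A).toReal - (‖η‖ ^ 2)⁻¹
      = (∫ ω, f ω ∂μ) / μ.real A := by
    rw [hfval, sub_div, mul_div_cancel_left₀ _ hA0.ne']
    rfl
  rw [hquot, abs_div, abs_of_pos hA0, div_le_div_iff₀ hA0 (by positivity)]
  nlinarith

lemma ProbabilityTheory.memLp_of_map_eq_gaussianReal {Ω : Type*} [MeasurableSpace Ω]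
    {μ : Measure Ω} {X : Ω → ℝ} (hX : Measurable X) {m : ℝ} {v : NNReal}
    (h : μ.map X = gaussianReal m v) {p : ENNReal} (hp : p ≠ ⊤) : MemLp X p μ :=
  (h ▸ memLp_id_gaussianReal' p hp : MemLp id p (μ.map X)).comp_of_map hX.aemeasurable

lemma ProbabilityTheory.integral_eq_of_map_eq_gaussianReal {Ω : Type*} [MeasurableSpace Ω]
    {μ : Measure Ω} {X : Ω → ℝ} (hX : Measurable X) {m : ℝ} {v : NNReal}
    (h : μ.map X = gaussianReal m v) : ∫ ω, X ω ∂μ = m := by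
  rw [← integral_map (f := fun x ↦ x) hX.aemeasurable (by fun_prop), h, integral_id_gaussianReal]

/-- Lemma 1, eq. (14): If `V` is a standard complex Gaussian and
`Z = η + V`, then `E[1/|Z|² | |Z| > 2] = 1/|η|² + O(1/|η|⁴)` as `|η| → ∞`. -/
theorem sw_lemma1_inverse_square
    {Ω : Type*} [MeasurableSpace Ω] (μ : Measure Ω) [IsProbabilityMeasure μ]
    (Vr Vi : Ω → ℝ) (hVrm : Measurable Vr) (hVim : Measurable Vi)
    (hVr : μ.map Vr = gaussianReal 0 (1 / 2)) (hVi : μ.map Vi = gaussianReal 0 (1 / 2))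
    (hindep : IndepFun Vr Vi μ)
    (V : Ω → ℂ) (hV : ∀ ω, V ω = (Vr ω : ℂ) + (Vi ω : ℂ) * Complex.I) :
    ∃ C > 0, ∃ η₀ > 0, ∀ η : ℂ, η₀ ≤ ‖η‖ →
      |(∫ ω in {ω | 2 < ‖η + V ω‖}, (‖η + V ω‖ ^ 2)⁻¹ ∂μ)
          / (μ {ω | 2 < ‖η + V ω‖}).toReal
        - (‖η‖ ^ 2)⁻¹| ≤ C / ‖η‖ ^ 4 := by
  obtain rfl : V = fun ω ↦ (Vr ω : ℂ) + (Vi ω : ℂ) * Complex.I := funext hV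
  refine exists_abs_cond_inv_sq_norm_add_sub_le μ (by fun_prop) ?_ ?_ ?_
  · have hr : MemLp Vr 4 μ := memLp_of_map_eq_gaussianReal hVrm hVr (by norm_num)
    have hi : MemLp Vi 4 μ := memLp_of_map_eq_gaussianReal hVim hVi (by norm_num)
    have hrC : MemLp (fun ω ↦ (Vr ω : ℂ)) 4 μ := hr.ofReal
    have hiC : MemLp (fun ω ↦ (Vi ω : ℂ)) 4 μ := hi.ofReal
    exact hrC.add (hiC.mul_const Complex.I)
  · simpa using integral_eq_of_map_eq_gaussianReal hVrm hVr
  · simpa using integral_eq_of_map_eq_gaussianReal hVim hVi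
end

section
/- Let V be a standard complex Gaussian random variable, i.e., V = V_r + i·V_i where V_r and V_i are independent real Gaussian random variables with mean 0 and variance 1/2, and for nonzero η ∈ ℂ set Z = η + V. Then there exist constants C > 0 and η₀ > 0 such that for all η with |η| ≥ η₀, | E[ (V/(η·|Z|^2)) · 1{|Z| > 2} ] / P(|Z| > 2) | ≤ C/|η|^4; that is, the conditional expectation E[V/(η|Z|^2) given |Z| > 2] is O(1/|η|^4) as |η| → ∞. -/
open MeasureTheory ProbabilityTheory Complex

/-- Replacing the weight `1/‖η + v‖²` by `1/‖η‖²` outside the disc `‖η + v‖ ≤ 2`, and by zero inside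
it, costs a polynomial in `‖v‖` times `‖η‖⁻⁴`. -/
lemma norm_ite_div_sub_le {η : ℂ} (hη : 4 ≤ ‖η‖) (v : ℂ) :
    ‖(if 2 < ‖η + v‖ then v / (η * ((‖η + v‖ ^ 2 : ℝ) : ℂ)) else 0)
        - v / (η * ((‖η‖ ^ 2 : ℝ) : ℂ))‖
      ≤ (4 * ‖v‖ ^ 2 + 2 * ‖v‖ ^ 3 + 2 * ‖v‖ ^ 4 + ‖v‖ ^ 5) / ‖η‖ ^ 4 := by
  have hη0 : 0 < ‖η‖ := by linarith
  have hηne : η ≠ 0 := norm_pos_iff.mp hη0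
  have hv := norm_nonneg v
  have htri : ‖η‖ ≤ ‖η + v‖ + ‖v‖ := by
    simpa using norm_sub_le (η + v) v
  have htri2 : ‖η + v‖ ≤ ‖η‖ + ‖v‖ := norm_add_le η v
  split_ifs with h
  · have hz0 : 0 < ‖η + v‖ := by linarith
    have hzc : ((‖η + v‖ : ℝ) : ℂ) ≠ 0 := by exact_mod_cast hz0.ne'
    have hec : ((‖η‖ : ℝ) : ℂ) ≠ 0 := by exact_mod_cast hη0.ne'
    have heq : v / (η * ((‖η + v‖ ^ 2 : ℝ) : ℂ)) - v / (η * ((‖η‖ ^ 2 : ℝ) : ℂ))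
        = v / η * (((‖η‖ ^ 2 - ‖η + v‖ ^ 2) / (‖η + v‖ ^ 2 * ‖η‖ ^ 2) : ℝ) : ℂ) := by
      push_cast
      field_simp
    rw [heq, norm_mul, norm_div, norm_real, Real.norm_eq_abs, abs_div,
      abs_of_pos (show 0 < ‖η + v‖ ^ 2 * ‖η‖ ^ 2 by positivity)]
    generalize ‖η + v‖ = z at *
    generalize ‖η‖ = e at *
    generalize ‖v‖ = a at *
    have h1 : |e ^ 2 - z ^ 2| ≤ a * (2 * e + a) := by
      rw [abs_le]
      constructor
      · nlinarith
      · rcases le_total a e with hae | hae <;> nlinarith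
    have h2 : e ^ 2 ≤ (2 + a ^ 2 / 2) * z ^ 2 := by
      nlinarith [sq_nonneg (z - a), mul_nonneg (sq_nonneg a) (show 0 ≤ z ^ 2 - 4 by nlinarith)]
    have h3 : 2 * e + a ≤ e * (2 + a) := by nlinarith
    rw [div_mul_div_comm, div_le_div_iff₀ (by positivity) (by positivity)]
    calc a * |e ^ 2 - z ^ 2| * e ^ 4 ≤ a * (a * (e * (2 + a))) * (e ^ 2 * e ^ 2) := by
          rw [← pow_add]
          gcongr
          exact h1.trans (by gcongr)
      _ ≤ a * (a * (e * (2 + a))) * ((2 + a ^ 2 / 2) * z ^ 2 * e ^ 2) := by gcongr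
      _ ≤ a * (a * (e * (2 + a))) * ((2 + a ^ 2) * z ^ 2 * e ^ 2) := by
          gcongr
          nlinarith
      _ = _ := by ring
  · rw [zero_sub, norm_neg, norm_div, norm_mul, norm_real, Real.norm_eq_abs,
      abs_of_pos (show 0 < ‖η‖ ^ 2 by positivity)]
    have ha : ‖η‖ ≤ 2 * ‖v‖ := by linarith
    rw [div_le_div_iff₀ (by positivity) (by positivity)]
    calc ‖v‖ * ‖η‖ ^ 4 = ‖v‖ * ‖η‖ * ‖η‖ ^ 3 := by ring
      _ ≤ ‖v‖ * (2 * ‖v‖) * ‖η‖ ^ 3 := by gcongr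
      _ = 2 * ‖v‖ ^ 2 * (‖η‖ * ‖η‖ ^ 2) := by ring
      _ ≤ _ := by
          gcongr
          have : 0 ≤ 2 * ‖v‖ ^ 2 + 2 * ‖v‖ ^ 3 + 2 * ‖v‖ ^ 4 + ‖v‖ ^ 5 := by positivity
          linarith

/-- For a square-integrable `V`, the disc `‖η + V‖ ≤ 2` has probability at most `1/2` as soon as
`‖η‖` is large. -/
lemma half_le_measureReal_two_lt_norm_add {Ω : Type*} [MeasurableSpace Ω] {μ : Measure Ω}
    [IsProbabilityMeasure μ] {V : Ω → ℂ} (hVm : Measurable V)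
    (hV : Integrable (fun ω ↦ ‖V ω‖ ^ 2) μ) {η : ℂ}
    (hη : 4 + 2 * ∫ ω, ‖V ω‖ ^ 2 ∂μ ≤ ‖η‖) :
    1 / 2 ≤ μ.real {ω | 2 < ‖η + V ω‖} := by
  have hs : MeasurableSet {ω | 2 < ‖η + V ω‖} :=
    measurableSet_lt measurable_const (hVm.const_add η).norm
  have hm : 0 ≤ ∫ ω, ‖V ω‖ ^ 2 ∂μ := integral_nonneg fun ω ↦ by positivity
  have hη4 : 4 ≤ ‖η‖ := by linarith
  have hmark := mul_meas_ge_le_integral_of_nonneg (μ := μ)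
    (.of_forall fun ω ↦ by positivity) hV (‖η‖ ^ 2 / 4)
  have hsub : μ.real {ω | 2 < ‖η + V ω‖}ᶜ ≤ μ.real {ω | ‖η‖ ^ 2 / 4 ≤ ‖V ω‖ ^ 2} := by
    refine measureReal_mono fun ω hω ↦ ?_
    simp only [Set.mem_compl_iff, Set.mem_ofPred_eq, not_lt] at hω ⊢
    have : ‖η‖ ≤ ‖η + V ω‖ + ‖V ω‖ := by simpa using norm_sub_le (η + V ω) (V ω)
    nlinarith
  rw [probReal_compl_eq_one_sub hs] at hsub
  have hle : μ.real {ω | ‖η‖ ^ 2 / 4 ≤ ‖V ω‖ ^ 2} ≤ 1 / 2 := by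
    by_contra! hlt
    nlinarith
  linarith

/-- Lemma 1, eq. (15): If `V` is a standard complex Gaussian and
`Z = η + V`, then `E[V/(η·|Z|²) | |Z| > 2] = O(1/|η|⁴)` as `|η| → ∞`. -/
theorem sw_lemma1_cross_term
    {Ω : Type*} [MeasurableSpace Ω] (μ : Measure Ω) [IsProbabilityMeasure μ]
    (Vr Vi : Ω → ℝ) (hVrm : Measurable Vr) (hVim : Measurable Vi)
    (hVr : μ.map Vr = gaussianReal 0 (1 / 2)) (hVi : μ.map Vi = gaussianReal 0 (1 / 2))
    (hindep : IndepFun Vr Vi μ)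
    (V : Ω → ℂ) (hV : ∀ ω, V ω = (Vr ω : ℂ) + (Vi ω : ℂ) * Complex.I) :
    ∃ C > 0, ∃ η₀ > 0, ∀ η : ℂ, η₀ ≤ ‖η‖ →
      ‖(∫ ω in {ω | 2 < ‖η + V ω‖},
            V ω / (η * ((‖η + V ω‖ ^ 2 : ℝ) : ℂ)) ∂μ)
          / ((((μ {ω | 2 < ‖η + V ω‖}).toReal : ℝ)) : ℂ)‖ ≤ C / ‖η‖ ^ 4 := by
  have hVm : Measurable V := by
    rw [funext hV]
    fun_prop
  have hmem {X : Ω → ℝ} (hX : Measurable X) (hlaw : μ.map X = gaussianReal 0 (1 / 2))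
      (p : ℕ) : MemLp X p μ := by
    have h : MemLp id (p : NNReal) (μ.map X) := hlaw ▸ memLp_id_gaussianReal (p : NNReal)
    simpa using h.comp_of_map hX.aemeasurable
  have hmean {X : Ω → ℝ} (hX : Measurable X) (hlaw : μ.map X = gaussianReal 0 (1 / 2)) :
      ∫ ω, X ω ∂μ = 0 := by
    rw [← integral_map (f := fun x ↦ x) hX.aemeasurable (by fun_prop), hlaw,
      integral_id_gaussianReal]
  have hVmem (p : ℕ) : MemLp V p μ := by
    have hr : MemLp (fun ω ↦ (Vr ω : ℂ)) p μ := (hmem hVrm hVr p).ofReal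
    have hi : MemLp (fun ω ↦ (Vi ω : ℂ)) p μ := (hmem hVim hVi p).ofReal
    rw [funext hV]
    exact hr.add (hi.mul_const I)
  have hpow (p : ℕ) : Integrable (fun ω ↦ ‖V ω‖ ^ p) μ := (hVmem p).integrable_norm_pow'
  have hVint : Integrable V μ := (hVmem 1).integrable (by simp)
  have hVmean : ∫ ω, V ω ∂μ = 0 := by
    have hr : Integrable (fun ω ↦ (Vr ω : ℂ)) μ :=
      ((hmem hVrm hVr 1).integrable (by simp)).ofReal
    have hi : Integrable (fun ω ↦ (Vi ω : ℂ)) μ :=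
      ((hmem hVim hVi 1).integrable (by simp)).ofReal
    simp_rw [hV]
    rw [integral_add hr (hi.mul_const I), integral_mul_const, integral_complex_ofReal,
      integral_complex_ofReal, hmean hVrm hVr, hmean hVim hVi]
    simp
  set G : Ω → ℝ := fun ω ↦ 4 * ‖V ω‖ ^ 2 + 2 * ‖V ω‖ ^ 3 + 2 * ‖V ω‖ ^ 4 + ‖V ω‖ ^ 5
  have hG : Integrable G μ :=
    ((((hpow 2).const_mul 4).add ((hpow 3).const_mul 2)).add ((hpow 4).const_mul 2)).add (hpow 5)
  have hG0 : 0 ≤ ∫ ω, G ω ∂μ := integral_nonneg fun ω ↦ by positivity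
  have hm : 0 ≤ ∫ ω, ‖V ω‖ ^ 2 ∂μ := integral_nonneg fun ω ↦ by positivity
  refine ⟨2 * ∫ ω, G ω ∂μ + 1, by positivity, 4 + 2 * ∫ ω, ‖V ω‖ ^ 2 ∂μ, by positivity,
    fun η hη ↦ ?_⟩
  have hη4 : 4 ≤ ‖η‖ := by linarith
  have hη0 : 0 < ‖η‖ := by linarith
  have hs : MeasurableSet {ω | 2 < ‖η + V ω‖} :=
    measurableSet_lt measurable_const (hVm.const_add η).norm
  set F : Ω → ℂ := fun ω ↦
    if 2 < ‖η + V ω‖ then V ω / (η * ((‖η + V ω‖ ^ 2 : ℝ) : ℂ)) else 0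
  have hFm : Measurable F := Measurable.ite hs (by fun_prop) measurable_const
  have hL : Integrable (fun ω ↦ V ω / (η * ((‖η‖ ^ 2 : ℝ) : ℂ))) μ := hVint.div_const _
  have hbound (ω : Ω) : ‖F ω - V ω / (η * ((‖η‖ ^ 2 : ℝ) : ℂ))‖ ≤ G ω / ‖η‖ ^ 4 :=
    norm_ite_div_sub_le hη4 (V ω)
  have hdiff : Integrable (fun ω ↦ F ω - V ω / (η * ((‖η‖ ^ 2 : ℝ) : ℂ))) μ :=
    (hG.div_const _).mono' (hFm.aestronglyMeasurable.sub hL.aestronglyMeasurable)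
      (.of_forall hbound)
  have hF : Integrable F μ := (hdiff.add hL).congr (.of_forall fun ω ↦ sub_add_cancel _ _)
  have hint : ‖∫ ω, F ω ∂μ‖ ≤ (∫ ω, G ω ∂μ) / ‖η‖ ^ 4 := by
    have h := norm_integral_le_of_norm_le (hG.div_const (‖η‖ ^ 4)) (.of_forall hbound)
    rwa [integral_sub hF hL, integral_div, hVmean, zero_div, sub_zero, integral_div] at h
  have hset : ∫ ω in {ω | 2 < ‖η + V ω‖}, V ω / (η * ((‖η + V ω‖ ^ 2 : ℝ) : ℂ)) ∂μ
      = ∫ ω, F ω ∂μ := by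
    rw [← integral_indicator hs]
    rfl
  have hP : 1 / 2 ≤ (μ {ω | 2 < ‖η + V ω‖}).toReal :=
    half_le_measureReal_two_lt_norm_add hVm (hpow 2) hη
  rw [hset, norm_div, norm_real, Real.norm_of_nonneg (by positivity)]
  calc ‖∫ ω, F ω ∂μ‖ / (μ {ω | 2 < ‖η + V ω‖}).toReal
      ≤ ((∫ ω, G ω ∂μ) / ‖η‖ ^ 4) / (1 / 2) := by gcongr
    _ = (2 * ∫ ω, G ω ∂μ) / ‖η‖ ^ 4 := by ring
    _ ≤ _ := by
        gcongr
        linarith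
end

section
/- Fix a nonzero complex number H and a real number S_v > 0, set σ_eff^2 = S_v/|H|^2, and define the Self-Wiener map by X̂_SW(z) = (√S_v/H)·z·(1 + √(1 - 4|z|^{-2}))/2 for complex z with |z| > 2 and X̂_SW(z) = 0 for |z| ≤ 2. Let V be a standard complex Gaussian random variable (V = V_r + i·V_i with V_r, V_i independent real Gaussians of mean 0 and variance 1/2). For X ∈ ℂ, let η = H·X/√S_v and MSE(X) = E[|X - X̂_SW(η + V)|^2]. Then there exist constants C > 0 and δ > 0 (depending only on H and S_v) such that for all X with |η| ≤ δ, | MSE(X) - |X|^2 - ρ·σ_eff^2 | ≤ C·|η|, where ρ = (1/4)·∫_8^∞ ( t/2 + √(t^2/4 - 2t) - 2 )·e^{-t/2} dt ≈ 0.0464. -/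
open MeasureTheory ProbabilityTheory Complex

/-- The Self-Wiener estimate as a function of the normalized observation `z`:
it thresholds at `|z| = 2` and otherwise shrinks the least-squares estimate
`(√S_v/H)·z` by the factor `(1 + √(1 - 4|z|⁻²))/2`. -/
noncomputable def swMap (H : ℂ) (Sv : ℝ) (z : ℂ) : ℂ :=
  if 2 < ‖z‖ then
    ((Real.sqrt Sv : ℂ) / H) * z
      * (((1 + Real.sqrt (1 - 4 * (‖z‖ ^ 2)⁻¹)) / 2 : ℝ) : ℂ)
  else 0

/-- The Self-Wiener map in the units of the normalized observation. -/
noncomputable def normalizedSw (z : ℂ) : ℂ :=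
  if 2 < ‖z‖ then z * (((1 + Real.sqrt (1 - 4 * (‖z‖ ^ 2)⁻¹)) / 2 : ℝ) : ℂ) else 0

lemma swMap_eq_mul_normalizedSw (H : ℂ) (Sv : ℝ) (z : ℂ) :
    swMap H Sv z = ((Real.sqrt Sv : ℂ) / H) * normalizedSw z := by
  unfold swMap normalizedSw
  split_ifs <;> ring

lemma measurable_normalizedSw : Measurable normalizedSw := by
  unfold normalizedSw
  refine Measurable.ite (measurableSet_lt measurable_const measurable_norm) ?_ measurable_const
  fun_prop

lemma norm_normalizedSw_le (z : ℂ) : ‖normalizedSw z‖ ≤ ‖z‖ := by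
  unfold normalizedSw
  split_ifs with h
  · have h1 : Real.sqrt (1 - 4 * (‖z‖ ^ 2)⁻¹) ≤ 1 := by
      rw [← Real.sqrt_one]
      apply Real.sqrt_le_sqrt
      have : 0 ≤ 4 * (‖z‖ ^ 2)⁻¹ := by positivity
      linarith
    have h0 := Real.sqrt_nonneg (1 - 4 * (‖z‖ ^ 2)⁻¹)
    rw [norm_mul, Complex.norm_real, Real.norm_eq_abs, abs_of_nonneg (by positivity)]
    exact mul_le_of_le_one_right (norm_nonneg z) (by linarith)
  · simp

/-- The squared modulus of the normalized Self-Wiener map, in terms of `t = 2|z|²`. -/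
lemma norm_normalizedSw_sq (z : ℂ) :
    ‖normalizedSw z‖ ^ 2 = (Set.Ioi (8 : ℝ)).indicator
      (fun t => (t / 2 + Real.sqrt (t ^ 2 / 4 - 2 * t) - 2) / 2) (2 * ‖z‖ ^ 2) := by
  unfold normalizedSw
  split_ifs with h
  · have hmem : 2 * ‖z‖ ^ 2 ∈ Set.Ioi (8 : ℝ) := by
      simp only [Set.mem_Ioi]; nlinarith
    rw [Set.indicator_of_mem hmem]
    set r := ‖z‖ with hr
    have hr0 : 0 < r := by linarith
    have h0 := Real.sqrt_nonneg (1 - 4 * (r ^ 2)⁻¹)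
    have hnn : 0 ≤ 1 - 4 * (r ^ 2)⁻¹ := by
      rw [sub_nonneg, ← div_eq_mul_inv, div_le_one (by positivity)]
      nlinarith
    have hs : Real.sqrt ((2 * r ^ 2) ^ 2 / 4 - 2 * (2 * r ^ 2))
        = r ^ 2 * Real.sqrt (1 - 4 * (r ^ 2)⁻¹) := by
      have harg : (2 * r ^ 2) ^ 2 / 4 - 2 * (2 * r ^ 2)
          = (r ^ 2) ^ 2 * (1 - 4 * (r ^ 2)⁻¹) := by
        field_simp
        ring
      rw [harg, Real.sqrt_mul (by positivity), Real.sqrt_sq (by positivity)]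
    have hsq := Real.sq_sqrt hnn
    rw [hs, norm_mul, Complex.norm_real, Real.norm_eq_abs, abs_of_nonneg (by positivity), ← hr]
    have : r ^ 2 * Real.sqrt (1 - 4 * (r ^ 2)⁻¹) ^ 2 = r ^ 2 - 4 := by
      rw [hsq]; field_simp
    linear_combination this / 4
  · have hmem : 2 * ‖z‖ ^ 2 ∉ Set.Ioi (8 : ℝ) := by
      simp only [Set.mem_Ioi, not_lt] at h ⊢
      nlinarith [norm_nonneg z]
    rw [Set.indicator_of_notMem hmem]
    simp

lemma integral_radial (f : ℝ → ℝ) :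
    ∫ z : ℂ, f (2 * ‖z‖ ^ 2) * complexGaussianPDF z
      = 1 / 2 * ∫ t in Set.Ioi (0 : ℝ), f t * Real.exp (-t / 2) := by
  have h1 := integral_fun_norm_addHaar (volume : Measure ℂ)
    (fun r => f (2 * r ^ 2) * (Real.pi⁻¹ * Real.exp (-r ^ 2)))
  have hvol : (volume : Measure ℂ).real (Metric.ball 0 1) = Real.pi := by
    simp [Measure.real, Complex.volume_ball]
  have h2 := integral_comp_rpow_Ioi_of_pos (g := fun s => f (2 * s) * Real.exp (-s))
    (p := 2) two_pos
  have h3 := integral_comp_mul_left_Ioi (fun t => f t * Real.exp (-t / 2)) 0 (b := 2) two_pos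
  simp only [Complex.finrank_real_complex, hvol, smul_eq_mul, nsmul_eq_mul] at h1 h2 h3
  unfold complexGaussianPDF
  rw [h1]
  rw [mul_zero] at h3
  have h4 : ∀ s : ℝ, -(2 * s) / 2 = -s := fun s => by ring
  simp only [h4] at h3
  rw [one_div, ← h3, ← h2, ← integral_const_mul, ← integral_const_mul]
  refine setIntegral_congr_fun measurableSet_Ioi fun r _ => ?_
  have h5 : r ^ (2 - 1 : ℝ) = r := by norm_num
  have h6 : r ^ (2 : ℝ) = r ^ 2 := by norm_cast
  simp only [h5, h6]
  field_simp
  norm_num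

/-- The energy of the normalized Self-Wiener estimate of pure noise. -/
lemma integral_norm_normalizedSw_sq :
    ∫ z : ℂ, ‖normalizedSw z‖ ^ 2 * complexGaussianPDF z
      = (1 / 4) * ∫ t in Set.Ioi (8 : ℝ),
          (t / 2 + Real.sqrt (t ^ 2 / 4 - 2 * t) - 2) * Real.exp (-t / 2) := by
  simp only [norm_normalizedSw_sq]
  rw [integral_radial]
  have h : ∀ t : ℝ, (Set.Ioi (8 : ℝ)).indicator
      (fun t => (t / 2 + Real.sqrt (t ^ 2 / 4 - 2 * t) - 2) / 2) t * Real.exp (-t / 2)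
      = (Set.Ioi (8 : ℝ)).indicator (fun t => 1 / 2 *
        ((t / 2 + Real.sqrt (t ^ 2 / 4 - 2 * t) - 2) * Real.exp (-t / 2))) t := by
    intro t
    by_cases ht : t ∈ Set.Ioi (8 : ℝ)
    · simp only [Set.indicator_of_mem ht]; ring
    · simp only [Set.indicator_of_notMem ht]; ring
  simp only [h]
  rw [setIntegral_indicator measurableSet_Ioi, Set.inter_eq_right.mpr
    (Set.Ioi_subset_Ioi (by norm_num)), integral_const_mul, ← mul_assoc]
  norm_num

/-- Expectations under a standard complex Gaussian as integrals against its density. -/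
lemma integral_comp_complexGaussian
    {Ω : Type*} [MeasurableSpace Ω] (μ : Measure Ω) [IsProbabilityMeasure μ]
    (Vr Vi : Ω → ℝ) (hVrm : Measurable Vr) (hVim : Measurable Vi)
    (hVr : μ.map Vr = gaussianReal 0 (1 / 2)) (hVi : μ.map Vi = gaussianReal 0 (1 / 2))
    (hindep : IndepFun Vr Vi μ)
    (V : Ω → ℂ) (hV : ∀ ω, V ω = (Vr ω : ℂ) + (Vi ω : ℂ) * Complex.I)
    (F : ℂ → ℝ) (hF : Measurable F) :
    ∫ ω, F (V ω) ∂μ = ∫ z, F z * complexGaussianPDF z := by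
  have hmap := (indepFun_iff_map_prod_eq_prod_map_map hVrm.aemeasurable hVim.aemeasurable).1 hindep
  rw [hVr, hVi, gaussianReal_of_var_ne_zero _ (by norm_num),
    prod_withDensity (measurable_gaussianPDF _ _) (measurable_gaussianPDF _ _)] at hmap
  have hG : Measurable (fun q : ℝ × ℝ => F ((q.1 : ℂ) + (q.2 : ℂ) * Complex.I)) := by
    fun_prop
  have h1 : ∫ ω, F (V ω) ∂μ
      = ∫ q, F ((q.1 : ℂ) + (q.2 : ℂ) * Complex.I) ∂(μ.map fun ω => (Vr ω, Vi ω)) := by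
    rw [integral_map (hVrm.prodMk hVim).aemeasurable hG.aestronglyMeasurable]
    simp only [hV]
  rw [h1, hmap, integral_withDensity_eq_integral_toReal_smul (by fun_prop)
    (.of_forall fun q => ENNReal.mul_lt_top gaussianPDF_lt_top gaussianPDF_lt_top),
    ← Measure.volume_eq_prod, ← Complex.volume_preserving_equiv_real_prod.integral_comp
      Complex.measurableEquivRealProd.measurableEmbedding]
  refine integral_congr_ae (.of_forall fun z => ?_)
  simp only [Complex.measurableEquivRealProd_apply, ENNReal.toReal_mul, toReal_gaussianPDF,
    gaussianPDFReal_def, Complex.re_add_im, smul_eq_mul, complexGaussianPDF]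
  have hz : ‖z‖ ^ 2 = z.re ^ 2 + z.im ^ 2 := by
    rw [Complex.sq_norm, Complex.normSq_apply]; ring
  have hs : Real.sqrt Real.pi ^ 2 = Real.pi := Real.sq_sqrt Real.pi_pos.le
  rw [hz, neg_add, Real.exp_add]
  have hc : (2 * Real.pi * ((1 / 2 : NNReal) : ℝ)) = Real.pi := by push_cast; ring
  have he : ∀ x : ℝ, -(x - 0) ^ 2 / (2 * ((1 / 2 : NNReal) : ℝ)) = -x ^ 2 := by
    intro x; push_cast; ring
  rw [hc, he, he]
  nth_rewrite 3 [← hs]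
  ring

lemma integrable_exp_neg_norm_sq_div_two :
    Integrable fun z : ℂ => Real.exp (-‖z‖ ^ 2 / 2) := by
  have h := (GaussianFourier.integrable_cexp_neg_mul_sq_norm_add (V := ℂ) (b := 1 / 2)
    (by norm_num) 0 0).norm
  refine h.congr (.of_forall fun z => ?_)
  have hz : (-(1 / 2) * (‖z‖ : ℂ) ^ 2 + 0 * ((inner ℝ 0 z : ℝ) : ℂ))
      = ((-‖z‖ ^ 2 / 2 : ℝ) : ℂ) := by
    push_cast; ring
  simp only [hz, Complex.norm_exp, Complex.ofReal_re]

lemma abs_exp_sub_one_le_mul_exp (u : ℝ) : |Real.exp u - 1| ≤ |u| * Real.exp |u| := by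
  have h1 := Real.add_one_le_exp u
  have h2 := Real.add_one_le_exp (-u)
  have h3 : Real.exp u * Real.exp (-u) = 1 := by rw [← Real.exp_add]; simp
  have hp := Real.exp_pos u
  rcases le_total 0 u with h | h
  · rw [abs_of_nonneg h, abs_of_nonneg (by linarith)]
    nlinarith
  · rw [abs_of_nonpos h, abs_of_nonpos (by linarith [Real.exp_le_one_iff.2 h])]
    have := Real.one_le_exp (neg_nonneg.2 h)
    nlinarith

lemma complexGaussianPDF_sub (z η : ℂ) :
    ∃ u : ℝ, |u| ≤ ‖η‖ * (2 * ‖z‖ + ‖η‖) ∧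
      complexGaussianPDF (z - η) = Real.exp u * complexGaussianPDF z := by
  refine ⟨‖z‖ ^ 2 - ‖z - η‖ ^ 2, ?_, ?_⟩
  · have h1 := abs_norm_sub_norm_le z (z - η)
    rw [sub_sub_cancel] at h1
    have h2 := norm_sub_le z η
    have h3 : 0 ≤ ‖z‖ + ‖z - η‖ := by positivity
    rw [sq_sub_sq, abs_mul, mul_comm, abs_of_nonneg h3]
    exact mul_le_mul h1 (by linarith) (by positivity) (by positivity)
  · unfold complexGaussianPDF
    rw [mul_left_comm, ← Real.exp_add]
    ring_nf

lemma exp_mul_complexGaussianPDF_le (z : ℂ) :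
    Real.exp (6 * ‖z‖ + 1) * complexGaussianPDF z
      ≤ Real.exp 19 * Real.exp (-‖z‖ ^ 2 / 2) := by
  unfold complexGaussianPDF
  rw [mul_left_comm, ← Real.exp_add, ← Real.exp_add]
  have h1 : Real.exp (6 * ‖z‖ + 1 + -‖z‖ ^ 2) ≤ Real.exp (19 + -‖z‖ ^ 2 / 2) :=
    Real.exp_le_exp.2 (by nlinarith [sq_nonneg (‖z‖ - 6)])
  have h2 : Real.pi⁻¹ ≤ 1 := inv_le_one_of_one_le₀ (by linarith [Real.pi_gt_three])
  calc _ ≤ Real.exp (6 * ‖z‖ + 1 + -‖z‖ ^ 2) :=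
        mul_le_of_le_one_left (Real.exp_pos _).le h2
    _ ≤ _ := h1

lemma complexGaussianPDF_sub_le (z η : ℂ) (hη : ‖η‖ ≤ 1) :
    complexGaussianPDF (z - η) ≤ Real.exp (2 * ‖z‖ + 1) * complexGaussianPDF z := by
  obtain ⟨u, hu, he⟩ := complexGaussianPDF_sub z η
  rw [he]
  refine mul_le_mul_of_nonneg_right (Real.exp_le_exp.2 ?_) (complexGaussianPDF_nonneg z)
  nlinarith [le_abs_self u, norm_nonneg z, norm_nonneg η]

lemma abs_complexGaussianPDF_sub_sub_le (z η : ℂ) (hη : ‖η‖ ≤ 1) :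
    |complexGaussianPDF (z - η) - complexGaussianPDF z|
      ≤ ‖η‖ * (Real.exp (4 * ‖z‖ + 1) * complexGaussianPDF z) := by
  obtain ⟨u, hu, he⟩ := complexGaussianPDF_sub z η
  have hp := complexGaussianPDF_nonneg z
  have hz := norm_nonneg z
  have hη0 := norm_nonneg η
  have hu1 : |u| ≤ ‖η‖ * (2 * ‖z‖ + 1) :=
    hu.trans (mul_le_mul_of_nonneg_left (by linarith) hη0)
  have hu2 : |u| ≤ 2 * ‖z‖ + 1 :=
    hu1.trans (mul_le_of_le_one_left (by positivity) hη)
  have h2 : 2 * ‖z‖ + 1 ≤ Real.exp (2 * ‖z‖) := Real.add_one_le_exp _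
  rw [he, ← sub_one_mul, abs_mul, abs_of_nonneg hp, ← mul_assoc]
  refine mul_le_mul_of_nonneg_right ?_ hp
  calc _ ≤ |u| * Real.exp |u| := abs_exp_sub_one_le_mul_exp u
    _ ≤ (‖η‖ * Real.exp (2 * ‖z‖)) * Real.exp (2 * ‖z‖ + 1) := by
        refine mul_le_mul ?_ (Real.exp_le_exp.2 hu2) (Real.exp_pos _).le (by positivity)
        exact hu1.trans (mul_le_mul_of_nonneg_left h2 hη0)
    _ = _ := by
        rw [mul_assoc, ← Real.exp_add]; ring_nf

lemma norm_normalizedSw_sq_le_exp (z : ℂ) : ‖normalizedSw z‖ ^ 2 ≤ Real.exp (2 * ‖z‖) := by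
  have h := norm_normalizedSw_le z
  have h1 : ‖z‖ ≤ Real.exp ‖z‖ := by linarith [Real.add_one_le_exp ‖z‖]
  calc _ ≤ Real.exp ‖z‖ ^ 2 := pow_le_pow_left₀ (norm_nonneg _) (h.trans h1) 2
    _ = _ := by rw [← Real.exp_nat_mul]; norm_num

/-- The pointwise error made by dropping the signal, relative to a Gaussian envelope. -/
lemma abs_error_integrand_le (z η : ℂ) (hη : ‖η‖ ≤ 1) :
    |(‖η - normalizedSw z‖ ^ 2 - ‖η‖ ^ 2) * complexGaussianPDF (z - η)
        - ‖normalizedSw z‖ ^ 2 * complexGaussianPDF z|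
      ≤ ‖η‖ * (3 * Real.exp 19 * Real.exp (-‖z‖ ^ 2 / 2)) := by
  set g := normalizedSw z
  have hp := complexGaussianPDF_nonneg z
  have hq := complexGaussianPDF_nonneg (z - η)
  have hcross : |‖η - g‖ ^ 2 - ‖η‖ ^ 2 - ‖g‖ ^ 2| ≤ 2 * (‖η‖ * ‖g‖) := by
    have h := norm_sub_sq_real η g
    have h2 := abs_real_inner_le_norm η g
    rw [h, show ‖η‖ ^ 2 - 2 * inner ℝ η g + ‖g‖ ^ 2 - ‖η‖ ^ 2 - ‖g‖ ^ 2 = -(2 * inner ℝ η g) by ring,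
      abs_neg, abs_mul, abs_two]
    linarith
  have hg : ‖g‖ ≤ Real.exp (4 * ‖z‖) := by
    have h1 := norm_normalizedSw_le z
    have := Real.add_one_le_exp (4 * ‖z‖)
    linarith [norm_nonneg z]
  have hcross' : |(‖η - g‖ ^ 2 - ‖η‖ ^ 2 - ‖g‖ ^ 2) * complexGaussianPDF (z - η)|
      ≤ 2 * (‖η‖ * (Real.exp (6 * ‖z‖ + 1) * complexGaussianPDF z)) := by
    rw [abs_mul, abs_of_nonneg hq]
    calc _ ≤ (2 * (‖η‖ * Real.exp (4 * ‖z‖)))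
          * (Real.exp (2 * ‖z‖ + 1) * complexGaussianPDF z) := by
          refine mul_le_mul (hcross.trans ?_) (complexGaussianPDF_sub_le z η hη) hq (by positivity)
          gcongr
      _ = 2 * (‖η‖ * ((Real.exp (4 * ‖z‖) * Real.exp (2 * ‖z‖ + 1)) * complexGaussianPDF z)) := by
          ring
      _ = _ := by rw [← Real.exp_add]; ring_nf
  have hshift : |‖g‖ ^ 2 * (complexGaussianPDF (z - η) - complexGaussianPDF z)|
      ≤ ‖η‖ * (Real.exp (6 * ‖z‖ + 1) * complexGaussianPDF z) := by
    rw [abs_mul, abs_of_nonneg (by positivity)]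
    calc _ ≤ Real.exp (2 * ‖z‖) * (‖η‖ * (Real.exp (4 * ‖z‖ + 1) * complexGaussianPDF z)) :=
          mul_le_mul (norm_normalizedSw_sq_le_exp z) (abs_complexGaussianPDF_sub_sub_le z η hη)
            (abs_nonneg _) (Real.exp_pos _).le
      _ = ‖η‖ * ((Real.exp (2 * ‖z‖) * Real.exp (4 * ‖z‖ + 1)) * complexGaussianPDF z) := by ring
      _ = _ := by rw [← Real.exp_add]; ring_nf
  have henv := mul_le_mul_of_nonneg_left (exp_mul_complexGaussianPDF_le z) (norm_nonneg η)
  calc _ = |(‖η - g‖ ^ 2 - ‖η‖ ^ 2 - ‖g‖ ^ 2) * complexGaussianPDF (z - η)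
          + ‖g‖ ^ 2 * (complexGaussianPDF (z - η) - complexGaussianPDF z)| := by ring_nf
    _ ≤ _ := abs_add_le _ _
    _ ≤ _ := by linarith

lemma integrable_norm_normalizedSw_sq_mul :
    Integrable fun z : ℂ => ‖normalizedSw z‖ ^ 2 * complexGaussianPDF z := by
  refine (integrable_exp_neg_norm_sq_div_two.const_mul (Real.exp 19)).mono'
    ((measurable_normalizedSw.norm.pow_const 2).mul
      continuous_complexGaussianPDF.measurable).aestronglyMeasurable (.of_forall fun z => ?_)
  have hp := complexGaussianPDF_nonneg z
  rw [Real.norm_eq_abs, abs_of_nonneg (by positivity)]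
  refine le_trans (mul_le_mul_of_nonneg_right ?_ hp) (exp_mul_complexGaussianPDF_le z)
  exact (norm_normalizedSw_sq_le_exp z).trans
    (Real.exp_le_exp.2 (by linarith [norm_nonneg z]))

lemma integrable_complexGaussianPDF : Integrable complexGaussianPDF := by
  refine (integrable_exp_neg_norm_sq_div_two.const_mul (Real.exp 19)).mono'
    continuous_complexGaussianPDF.aestronglyMeasurable (.of_forall fun z => ?_)
  have hp := complexGaussianPDF_nonneg z
  rw [Real.norm_eq_abs, abs_of_nonneg hp]
  refine le_trans (le_mul_of_one_le_left hp ?_) (exp_mul_complexGaussianPDF_le z)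
  exact Real.one_le_exp (by positivity)

/-- The low-SNR bound for the risk in normalized units. -/
lemma abs_integral_normalized_risk_sub_le (hone : ∫ z, complexGaussianPDF z = 1) (η : ℂ)
    (hη : ‖η‖ ≤ 1) :
    |(∫ z, ‖η - normalizedSw (η + z)‖ ^ 2 * complexGaussianPDF z) - ‖η‖ ^ 2
        - ∫ z, ‖normalizedSw z‖ ^ 2 * complexGaussianPDF z|
      ≤ (∫ z : ℂ, 3 * Real.exp 19 * Real.exp (-‖z‖ ^ 2 / 2)) * ‖η‖ := by
  set E : ℂ → ℝ := fun z => (‖η - normalizedSw z‖ ^ 2 - ‖η‖ ^ 2) * complexGaussianPDF (z - η)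
        - ‖normalizedSw z‖ ^ 2 * complexGaussianPDF z with hE
  have henv : Integrable fun z : ℂ => ‖η‖ * (3 * Real.exp 19 * Real.exp (-‖z‖ ^ 2 / 2)) :=
    (integrable_exp_neg_norm_sq_div_two.const_mul _).const_mul _
  have hEmeas : Measurable E := by
    have := measurable_normalizedSw
    have := continuous_complexGaussianPDF.measurable
    fun_prop
  have hEint : Integrable E :=
    henv.mono' hEmeas.aestronglyMeasurable (.of_forall fun z => abs_error_integrand_le z η hη)
  have hshift : Integrable fun z => ‖η‖ ^ 2 * complexGaussianPDF (z - η) :=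
    (integrable_complexGaussianPDF.comp_sub_right η).const_mul _
  have hrisk : ∫ z, ‖η - normalizedSw (η + z)‖ ^ 2 * complexGaussianPDF z
      = ∫ z, (E z + ‖η‖ ^ 2 * complexGaussianPDF (z - η))
          + ‖normalizedSw z‖ ^ 2 * complexGaussianPDF z := by
    rw [← integral_sub_right_eq_self _ η]
    refine integral_congr_ae (.of_forall fun z => ?_)
    simp only [hE, add_sub_cancel]
    ring
  have hsum : Integrable fun z => E z + ‖η‖ ^ 2 * complexGaussianPDF (z - η) := hEint.add hshift
  rw [hrisk, integral_add hsum integrable_norm_normalizedSw_sq_mul,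
    integral_add hEint hshift, integral_const_mul, integral_sub_right_eq_self, hone, mul_one,
    add_sub_right_comm, add_sub_cancel_right, add_sub_cancel_right, mul_comm,
    ← integral_const_mul]
  exact norm_integral_le_of_norm_le (f := E) henv (.of_forall fun z => abs_error_integrand_le z η hη)

/-- Theorem 3, low-SNR MSE: with `η = H·X/√S_v` and
`MSE(X) = E[|X - X̂_SW(η + V)|²]` for standard complex Gaussian noise `V`, there
are `C, δ > 0` such that for all `X` with `|η| ≤ δ`,
`|MSE(X) - |X|² - ρ·σ_eff²| ≤ C·|η|`, where
`ρ = (1/4)·∫_8^∞ (t/2 + √(t²/4 - 2t) - 2)·e^{-t/2} dt` and `σ_eff² = S_v/|H|²`. -/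
theorem sw_mse_low_snr
    {Ω : Type*} [MeasurableSpace Ω] (μ : Measure Ω) [IsProbabilityMeasure μ]
    (H : ℂ) (hH : H ≠ 0) (Sv : ℝ) (hSv : 0 < Sv)
    (Vr Vi : Ω → ℝ) (hVrm : Measurable Vr) (hVim : Measurable Vi)
    (hVr : μ.map Vr = gaussianReal 0 (1 / 2)) (hVi : μ.map Vi = gaussianReal 0 (1 / 2))
    (hindep : IndepFun Vr Vi μ)
    (V : Ω → ℂ) (hV : ∀ ω, V ω = (Vr ω : ℂ) + (Vi ω : ℂ) * Complex.I) :
    let σeff2 : ℝ := Sv / ‖H‖ ^ 2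
    let ρ : ℝ := (1 / 4) * ∫ t in Set.Ioi (8 : ℝ),
      (t / 2 + Real.sqrt (t ^ 2 / 4 - 2 * t) - 2) * Real.exp (-t / 2)
    ∃ C > 0, ∃ δ > 0, ∀ X : ℂ, ‖H * X / (Real.sqrt Sv : ℂ)‖ ≤ δ →
      |(∫ ω, ‖X - swMap H Sv (H * X / (Real.sqrt Sv : ℂ) + V ω)‖ ^ 2 ∂μ)
          - ‖X‖ ^ 2 - ρ * σeff2|
        ≤ C * ‖H * X / (Real.sqrt Sv : ℂ)‖ := by
  intro σeff2 ρ
  set c : ℂ := (Real.sqrt Sv : ℂ) / H with hc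
  have hsv : (Real.sqrt Sv : ℂ) ≠ 0 := by
    exact_mod_cast (Real.sqrt_pos.2 hSv).ne'
  have hcσ : ‖c‖ ^ 2 = σeff2 := by
    rw [hc, norm_div, div_pow, Complex.norm_real, Real.norm_eq_abs, sq_abs, Real.sq_sqrt hSv.le]
  have hlaw := integral_comp_complexGaussian μ Vr Vi hVrm hVim hVr hVi hindep V hV
  have hone : ∫ z, complexGaussianPDF z = 1 := by
    have h := hlaw (fun _ => 1) measurable_const
    simpa using h.symm
  have hσ : 0 < σeff2 := div_pos hSv (by positivity)
  set K : ℝ := ∫ z : ℂ, 3 * Real.exp 19 * Real.exp (-‖z‖ ^ 2 / 2)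
  have hK : 0 ≤ K := integral_nonneg fun z => by positivity
  refine ⟨σeff2 * (K + 1), by positivity, 1, one_pos, fun X hX => ?_⟩
  set η : ℂ := H * X / (Real.sqrt Sv : ℂ) with hη
  have hXη : X = c * η := by
    rw [hc, hη]; field_simp
  have hfac : ∀ ω, ‖X - swMap H Sv (η + V ω)‖ ^ 2
      = σeff2 * ‖η - normalizedSw (η + V ω)‖ ^ 2 := by
    intro ω
    rw [swMap_eq_mul_normalizedSw, ← hc, ← hcσ, ← mul_pow, ← norm_mul, mul_sub, ← hXη]
  have hmeas : Measurable fun z => ‖η - normalizedSw (η + z)‖ ^ 2 := by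
    have := measurable_normalizedSw
    fun_prop
  have hXn : ‖X‖ ^ 2 = σeff2 * ‖η‖ ^ 2 := by
    rw [← hcσ, ← mul_pow, ← norm_mul, ← hXη]
  have hmain := abs_integral_normalized_risk_sub_le hone η hX
  simp only [hfac]
  rw [integral_const_mul, hlaw _ hmeas, hXn, mul_comm ρ, ← mul_sub, ← mul_sub, abs_mul,
    abs_of_pos hσ, mul_assoc]
  refine mul_le_mul_of_nonneg_left ?_ hσ.le
  rw [integral_norm_normalizedSw_sq] at hmain
  exact hmain.trans (mul_le_mul_of_nonneg_right (by linarith) (norm_nonneg η))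
end
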